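/- Let L ⊂ K be two ℍ-hulls, w ∈ ℝ, and w̃ ∈ [c_L^w, d_L^w]. With g_L^w revised so that when g_L^w(x) = w̃ one sets the value equal to w̃^{sign(x-w)}, the modified Loewner maps satisfy the composition identity g_{K/L}^{w̃} ∘ g_L^w = g_K^w on ℝ_w ∪ {±∞}. -/

import Mathlib

open Complex Filter Set Metric Bornology Topology

noncomputable section

/-- The open upper half-plane `ℍ`. -/
def UHP : Set ℂ := {z : ℂ | 0 < z.im}

/-- `K^doub`: the closure of `K` together with its reflection across `ℝ`. -/
def Kdoub (K : Set ℂ) : Set ℂ := closure K ∪ (starRingEnd ℂ) '' closure K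

/-- `a_K = min (cl K ∩ ℝ)`. -/
def aK (K : Set ℂ) : ℝ := sInf {x : ℝ | (x : ℂ) ∈ closure K}

/-- `b_K = max (cl K ∩ ℝ)`. -/
def bK (K : Set ℂ) : ℝ := sSup {x : ℝ | (x : ℂ) ∈ closure K}

/-- The segment `[a_K, b_K]` regarded as a subset of `ℂ`. -/
def seg (K : Set ℂ) : Set ℂ := (fun t : ℝ => (t : ℂ)) '' Set.Icc (aK K) (bK K)

/-- `K` is an `ℍ`-hull with mapping-out function `g` (normalized hydrodynamically at `∞`),
whose Schwarz reflection maps the complement of `K^doub ∪ [a_K, b_K]` onto `ℂ \ S_K`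
for the compact set `S = S_K ⊆ ℝ`. -/
structure IsHullMap (K : Set ℂ) (g : ℂ → ℂ) (S : Set ℝ) : Prop where
  subset_UHP : K ⊆ UHP
  bounded : IsBounded K
  relClosed : ∀ z ∈ closure K, 0 < z.im → z ∈ K
  holo : DifferentiableOn ℂ g (UHP \ K)
  bij : Set.BijOn g (UHP \ K) UHP
  hydro : Tendsto (fun z => g z - z) (Bornology.cobounded ℂ) (nhds 0)
  compactS : IsCompact S
  ext_holo : K.Nonempty → DifferentiableOn ℂ g {z : ℂ | z ∉ Kdoub K}
  real_vals : K.Nonempty → ∀ x : ℝ, (x : ℂ) ∉ Kdoub K → (g (x : ℂ)).im = 0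
  conj_symm : K.Nonempty → ∀ z : ℂ, z ∉ Kdoub K → g ((starRingEnd ℂ) z) = (starRingEnd ℂ) (g z)
  extBij : K.Nonempty →
    Set.BijOn g {z : ℂ | z ∉ Kdoub K ∧ z ∉ seg K} {z : ℂ | ∀ s ∈ S, z ≠ (s : ℂ)}

/-- `g` has half-plane capacity `c` : `g z = z + c / z + O(1/z²)` near `∞`. -/
def HasHcap (g : ℂ → ℂ) (c : ℝ) : Prop :=
  Tendsto (fun z : ℂ => z * (g z - z)) (Bornology.cobounded ℂ) (nhds (c : ℂ))

/-- `a_K^w = min {w, a_K}`. -/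
def awF (K : Set ℂ) (w : ℝ) : ℝ := min w (aK K)

/-- `b_K^w = max {w, b_K}`. -/
def bwF (K : Set ℂ) (w : ℝ) : ℝ := max w (bK K)

/-- `c_K^w = lim_{x ↑ a_K^w} g_K(x)`. -/
def cwF (g : ℂ → ℂ) (K : Set ℂ) (w : ℝ) : ℝ :=
  sSup ((fun t : ℝ => (g (t : ℂ)).re) '' Set.Iio (awF K w))

/-- `d_K^w = lim_{x ↓ b_K^w} g_K(x)`. -/
def dwF (g : ℂ → ℂ) (K : Set ℂ) (w : ℝ) : ℝ :=
  sInf ((fun t : ℝ => (g (t : ℂ)).re) '' Set.Ioi (bwF K w))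

/-- The modified Loewner map `g_K^w : ℝ_w → ℝ` of Definition 2.10; a point of `ℝ_w` is a pair
`(x, s)` with the Boolean side `s` relevant only at `x = w` (`false` = `w⁻`, `true` = `w⁺`). -/
def gmod (g : ℂ → ℂ) (K : Set ℂ) (w : ℝ) (x : ℝ) (s : Bool) : ℝ :=
  if x < awF K w then (g (x : ℂ)).re
  else if bwF K w < x then (g (x : ℂ)).re
  else if x < w ∨ (x = w ∧ s = false) then cwF g K w else dwF g K w

/-- The real-line data of a mapping-out function: `A` is the trace on `ℝ` of the closure of the
hull and `f` is the boundary extension of the mapping-out function to `ℝ`. -/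
structure IsRealHullMap (A : Set ℝ) (f : ℝ → ℝ) : Prop where
  compact : IsCompact A
  nonempty : A.Nonempty
  cont : ContinuousOn f Aᶜ
  inj : Set.InjOn f (Set.Icc (sInf A) (sSup A))ᶜ
  asymp : Tendsto (fun x => f x - x) (cobounded ℝ) (𝓝 0)

/-- The restriction of the modified map to the points to the left of the base point. -/
def leftMap (A : Set ℝ) (f : ℝ → ℝ) (x : ℝ) : ℝ := sSup (f '' Set.Iio (min x (sInf A)))

/-- The restriction of the modified map to the points to the right of the base point. -/
def rightMap (A : Set ℝ) (f : ℝ → ℝ) (x : ℝ) : ℝ := sInf (f '' Set.Ioi (max x (sSup A)))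

lemma rightMap_eq_neg_leftMap (A : Set ℝ) (f : ℝ → ℝ) (x : ℝ) :
    rightMap A f x = -leftMap (-A) (fun t => -f (-t)) (-x) := by
  have h : (fun t => -f (-t)) '' Set.Iio (min (-x) (-sSup A)) = -(f '' Set.Ioi (max x (sSup A))) := by
    rw [min_neg_neg]
    ext y
    simp only [Set.mem_image, Set.mem_Iio, Set.mem_neg, Set.mem_Ioi]
    constructor
    · rintro ⟨t, ht, rfl⟩
      exact ⟨-t, by linarith, by simp⟩
    · rintro ⟨t, ht, h⟩
      exact ⟨-t, by linarith, by simp [h]⟩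
  rw [leftMap, rightMap, Real.sInf_def, Real.sInf_def, neg_neg A, h]

namespace IsRealHullMap

variable {A : Set ℝ} {f : ℝ → ℝ}

lemma neg (h : IsRealHullMap A f) : IsRealHullMap (-A) (fun t => -f (-t)) where
  compact := h.compact.neg
  nonempty := h.nonempty.neg
  cont := by
    refine (h.cont.comp continuous_neg.continuousOn ?_).neg
    intro x hx
    simpa using hx
  inj := by
    have h1 : sInf (-A) = -sSup A := by rw [Real.sInf_def, neg_neg]
    have h2 : sSup (-A) = -sInf A := by rw [Real.sInf_def, neg_neg]
    rw [h1, h2]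
    intro x hx y hy hxy
    have key : ∀ x ∈ (Set.Icc (-sSup A) (-sInf A))ᶜ, -x ∈ (Set.Icc (sInf A) (sSup A))ᶜ := by
      intro x hx hx'
      exact hx ⟨by linarith [hx'.2], by linarith [hx'.1]⟩
    exact neg_injective (h.inj (key x hx) (key y hy) (neg_injective hxy))
  asymp := by
    have h1 : Tendsto (fun x : ℝ => -x) (cobounded ℝ) (cobounded ℝ) := tendsto_neg_cobounded
    have h2 := (h.asymp.comp h1).neg
    rw [neg_zero] at h2
    refine h2.congr fun x => ?_
    simp only [Function.comp_apply]
    ring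

lemma notMem_of_lt (h : IsRealHullMap A f) {x : ℝ} (hx : x < sInf A) : x ∉ A :=
  fun hA => absurd (csInf_le h.compact.bddBelow hA) (not_le.2 hx)

lemma contOn_Iio (h : IsRealHullMap A f) : ContinuousOn f (Set.Iio (sInf A)) :=
  h.cont.mono fun _ hx => h.notMem_of_lt hx

lemma exists_lt_map_lt (h : IsRealHullMap A f) (x y : ℝ) : ∃ z < x, f z < y := by
  have h1 : ∀ᶠ z in atBot, f z - z < 1 :=
    (h.asymp.mono_left (by rw [IsOrderBornology.cobounded_eq]; exact le_sup_left)).eventually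
      (gt_mem_nhds one_pos)
  obtain ⟨z, hz, hz1, hz2⟩ :=
    (h1.and ((eventually_lt_atBot x).and (eventually_lt_atBot (y - 1)))).exists
  exact ⟨z, hz1, by linarith⟩

lemma strictMonoOn (h : IsRealHullMap A f) : StrictMonoOn f (Set.Iio (sInf A)) := by
  intro x hx y hy hxy
  obtain ⟨z, hzx, hz⟩ := h.exists_lt_map_lt x (f x)
  have hsub : Set.Icc z y ⊆ Set.Iio (sInf A) := fun t ht => ht.2.trans_lt hy
  have hinj : Set.InjOn f (Set.Icc z y) :=
    h.inj.mono (show Set.Icc z y ⊆ (Set.Icc (sInf A) (sSup A))ᶜ from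
      fun t ht ht' => absurd ht'.1 (not_le.2 (hsub ht)))
  have hz' : z ∈ Set.Icc z y := ⟨le_rfl, (hzx.trans hxy).le⟩
  have hx' : x ∈ Set.Icc z y := ⟨hzx.le, hxy.le⟩
  have hy' : y ∈ Set.Icc z y := ⟨(hzx.trans hxy).le, le_rfl⟩
  rcases (h.contOn_Iio.mono hsub).strictMonoOn_of_injOn_Icc' (hzx.trans hxy).le hinj with hm | hm
  · exact hm hx' hy' hxy
  · exact absurd (hm hz' hx' hzx) (not_lt.2 hz.le)

/-- Every value below an attained value is attained further to the left. -/
lemma exists_lt_map_eq (h : IsRealHullMap A f) {x y : ℝ} (hx : x < sInf A) (hy : y < f x) :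
    ∃ t < x, f t = y := by
  obtain ⟨z, hzx, hz⟩ := h.exists_lt_map_lt x y
  have hsub : Set.Icc z x ⊆ Set.Iio (sInf A) := fun t ht => ht.2.trans_lt hx
  obtain ⟨t, ht, rfl⟩ := intermediate_value_Icc hzx.le (h.contOn_Iio.mono hsub) ⟨hz.le, hy.le⟩
  refine ⟨t, lt_of_le_of_ne ht.2 ?_, rfl⟩
  rintro rfl
  exact lt_irrefl _ hy

lemma bddAbove_image (h : IsRealHullMap A f) {m : ℝ} (hm : m ≤ sInf A) :
    BddAbove (f '' Set.Iio m) := by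
  refine ⟨f (sSup A + 1), ?_⟩
  rintro _ ⟨x, hx, rfl⟩
  by_contra! hlt
  have hle : sInf A ≤ sSup A := csInf_le_csSup h.nonempty h.compact.bddBelow h.compact.bddAbove
  have hxA : x < sInf A := lt_of_lt_of_le hx hm
  obtain ⟨t, ht, hft⟩ := h.exists_lt_map_eq hxA hlt
  have := h.inj (fun h' => absurd h'.1 (not_le.2 (ht.trans hxA)))
    (fun h' => absurd h'.2 (not_le.2 (lt_add_one _))) hft
  linarith

lemma leftMap_mono (h : IsRealHullMap A f) : Monotone (leftMap A f) := by
  intro x y hxy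
  exact csSup_le_csSup (h.bddAbove_image (min_le_right _ _)) (Set.nonempty_Iio.image f)
    (Set.image_mono (Set.Iio_subset_Iio (min_le_min_right _ hxy)))

lemma leftMap_of_lt (h : IsRealHullMap A f) {x : ℝ} (hx : x < sInf A) : leftMap A f x = f x := by
  rw [leftMap, min_eq_left hx.le]
  refine IsLUB.csSup_eq ⟨?_, ?_⟩ (Set.nonempty_Iio.image f)
  · rintro _ ⟨t, ht, rfl⟩
    exact (h.strictMonoOn (lt_trans ht hx) hx ht).le
  · intro u hu
    by_contra! hlt
    obtain ⟨v, huv, hv⟩ := exists_between hlt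
    obtain ⟨t, ht, rfl⟩ := h.exists_lt_map_eq hx hv
    exact absurd (hu ⟨t, ht, rfl⟩) (not_le.2 huv)

lemma leftMap_of_le {x : ℝ} (hx : sInf A ≤ x) : leftMap A f x = leftMap A f (sInf A) := by
  rw [leftMap, leftMap, min_eq_right hx, min_self]

lemma image_Iio (h : IsRealHullMap A f) {m : ℝ} (hm : m ≤ sInf A) :
    f '' Set.Iio m = Set.Iio (leftMap A f m) := by
  have hbdd := h.bddAbove_image hm
  rw [leftMap, min_eq_left hm]
  ext y
  constructor
  · rintro ⟨x, hx, rfl⟩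
    obtain ⟨x', hx1, hx2⟩ := exists_between (Set.mem_Iio.1 hx)
    exact (h.strictMonoOn (lt_of_lt_of_le hx hm) (lt_of_lt_of_le hx2 hm) hx1).trans_le
      (le_csSup hbdd ⟨x', hx2, rfl⟩)
  · intro hy
    obtain ⟨_, ⟨x, hx, rfl⟩, hyx⟩ := exists_lt_of_lt_csSup (Set.nonempty_Iio.image f) hy
    obtain ⟨t, ht, rfl⟩ := h.exists_lt_map_eq (lt_of_lt_of_le hx hm) hyx
    exact ⟨t, lt_trans ht hx, rfl⟩

lemma leftMap_comp {AK AL AQ : Set ℝ} {fK fL fQ : ℝ → ℝ} (hK : IsRealHullMap AK fK)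
    (hL : IsRealHullMap AL fL) (hQ : IsRealHullMap AQ fQ) (hsub : AL ⊆ AK)
    (hnot : ∀ x ∉ AK, fL x ∉ AQ) (hmem : ∀ x ∈ AK, x ∉ AL → fL x ∈ AQ)
    (hcomp : ∀ x ∉ AK, fQ (fL x) = fK x) (x : ℝ) :
    leftMap AK fK x = leftMap AQ fQ (leftMap AL fL x) := by
  have hle : sInf AK ≤ sInf AL := csInf_le_csInf hK.compact.bddBelow hL.nonempty hsub
  have haQ : leftMap AL fL (sInf AK) ≤ sInf AQ := by
    refine le_csInf hQ.nonempty fun y hy => ?_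
    by_contra! hlt
    rw [← Set.mem_Iio, ← hL.image_Iio hle] at hlt
    obtain ⟨t, ht, rfl⟩ := hlt
    exact hnot t (hK.notMem_of_lt ht) hy
  have hmin : min (leftMap AL fL x) (sInf AQ) = leftMap AL fL (min x (sInf AK)) := by
    rcases le_total x (sInf AK) with hx | hx
    · rw [min_eq_left hx, min_eq_left ((hL.leftMap_mono hx).trans haQ)]
    · rw [min_eq_right hx]
      rcases hle.eq_or_lt with heq | hlt
      · rw [heq] at hx haQ ⊢
        rw [leftMap_of_le hx, min_eq_left haQ]
      · have h1 : fL (sInf AK) ∈ AQ :=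
          hmem _ (hK.compact.sInf_mem hK.nonempty) (hL.notMem_of_lt hlt)
        have h2 := csInf_le hQ.compact.bddBelow h1
        rw [← hL.leftMap_of_lt hlt] at h2
        rw [← le_antisymm haQ h2, min_eq_right (hL.leftMap_mono hx)]
  rw [leftMap, leftMap, hmin, ← hL.image_Iio ((min_le_right _ _).trans hle), Set.image_image]
  congr 1
  exact Set.image_congr fun t ht =>
    (hcomp t (hK.notMem_of_lt (lt_of_lt_of_le ht (min_le_right _ _)))).symm

lemma rightMap_comp {AK AL AQ : Set ℝ} {fK fL fQ : ℝ → ℝ} (hK : IsRealHullMap AK fK)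
    (hL : IsRealHullMap AL fL) (hQ : IsRealHullMap AQ fQ) (hsub : AL ⊆ AK)
    (hnot : ∀ x ∉ AK, fL x ∉ AQ) (hmem : ∀ x ∈ AK, x ∉ AL → fL x ∈ AQ)
    (hcomp : ∀ x ∉ AK, fQ (fL x) = fK x) (x : ℝ) :
    rightMap AK fK x = rightMap AQ fQ (rightMap AL fL x) := by
  simp only [rightMap_eq_neg_leftMap, neg_neg]
  rw [leftMap_comp hK.neg hL.neg hQ.neg (Set.neg_subset_neg.2 hsub)]
  · intro y hy
    simpa using hnot _ hy
  · intro y hy hy'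
    simpa using hmem _ hy hy'
  · intro y hy
    simpa using hcomp _ hy

lemma rightMap_mono (h : IsRealHullMap A f) : Monotone (rightMap A f) := by
  intro x y hxy
  rw [rightMap_eq_neg_leftMap, rightMap_eq_neg_leftMap]
  exact neg_le_neg (h.neg.leftMap_mono (neg_le_neg hxy))

lemma rightMap_of_lt (h : IsRealHullMap A f) {x : ℝ} (hx : sSup A < x) :
    rightMap A f x = f x := by
  rw [rightMap_eq_neg_leftMap, h.neg.leftMap_of_lt, neg_neg, neg_neg]
  rw [Real.sInf_def, neg_neg]
  exact neg_lt_neg hx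

end IsRealHullMap

lemma gmod_eq_leftMap {g : ℂ → ℂ} {K : Set ℂ}
    (h : IsRealHullMap {x : ℝ | (x : ℂ) ∈ closure K} (fun t : ℝ => (g t).re))
    {w x : ℝ} {s : Bool} (hx : x < w ∨ (x = w ∧ s = false)) :
    gmod g K w x s = leftMap {x : ℝ | (x : ℂ) ∈ closure K} (fun t : ℝ => (g t).re) x := by
  have hxw : x ≤ w := hx.elim le_of_lt fun h => h.1.le
  unfold gmod
  split_ifs with h1 h2
  · exact (h.leftMap_of_lt (lt_of_lt_of_le h1 (min_le_right _ _))).symm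
  · exact absurd (lt_of_le_of_lt (le_max_left _ _) h2) (not_lt.2 hxw)
  · have hmin : awF K w = min x (aK K) := by
      rcases le_total x (aK K) with h3 | h3
      · rw [min_eq_left h3]
        exact le_antisymm (not_lt.1 h1) (le_min hxw h3)
      · rw [min_eq_right h3]
        exact min_eq_right (h3.trans hxw)
    rw [cwF, hmin, leftMap, aK]

lemma gmod_eq_rightMap {g : ℂ → ℂ} {K : Set ℂ}
    (h : IsRealHullMap {x : ℝ | (x : ℂ) ∈ closure K} (fun t : ℝ => (g t).re))
    {w x : ℝ} {s : Bool} (hx : w < x ∨ (x = w ∧ s = true)) :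
    gmod g K w x s = rightMap {x : ℝ | (x : ℂ) ∈ closure K} (fun t : ℝ => (g t).re) x := by
  have hxw : w ≤ x := hx.elim le_of_lt fun h => h.1.ge
  unfold gmod
  split_ifs with h1 h2 h3
  · exact absurd (lt_of_lt_of_le h1 (min_le_left _ _)) (not_lt.2 hxw)
  · exact (h.rightMap_of_lt (lt_of_le_of_lt (le_max_right _ _) h2)).symm
  · rcases h3 with h3 | ⟨rfl, rfl⟩
    · exact absurd h3 (not_lt.2 hxw)
    · simp at hx
  · have hmax : bwF K w = max x (bK K) := by
      rcases le_total x (bK K) with h3 | h3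
      · rw [max_eq_right h3]
        exact max_eq_right (hxw.trans h3)
      · rw [max_eq_left h3]
        exact le_antisymm (max_le hxw h3) (not_lt.1 h2)
    rw [dwF, hmax, rightMap, bK]

/-- A holomorphic map asymptotic to the identity at infinity covers a neighbourhood of infinity. -/
lemma cobounded_le_map_of_tendsto_sub {g : ℂ → ℂ}
    (hd : ∀ᶠ z in cobounded ℂ, DifferentiableAt ℂ g z)
    (hg : Tendsto (fun z => g z - z) (cobounded ℂ) (𝓝 0)) :
    cobounded ℂ ≤ map g (cobounded ℂ) := by
  have hinv : Tendsto (fun ζ : ℂ => ζ⁻¹) (𝓝[≠] 0) (cobounded ℂ) := tendsto_inv₀_nhdsNE_zero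
  have hinv' : Tendsto (fun ζ : ℂ => ζ⁻¹) (cobounded ℂ) (𝓝 0) := tendsto_inv₀_cobounded
  have hgc : Tendsto g (cobounded ℂ) (cobounded ℂ) := by
    rw [← tendsto_norm_atTop_iff_cobounded]
    have h1 : ∀ᶠ z in cobounded ℂ, ‖g z - z‖ < 1 := by
      simpa using hg.norm.eventually (gt_mem_nhds (by simp))
    have h2 : Tendsto (fun z : ℂ => ‖z‖ - 1) (cobounded ℂ) atTop :=
      tendsto_atTop_add_const_right _ (-1) tendsto_norm_cobounded_atTop
    refine tendsto_atTop_mono' _ ?_ h2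
    filter_upwards [h1] with z hz
    have := norm_sub_norm_le z (g z)
    rw [norm_sub_rev] at this
    linarith
  set h : ℂ → ℂ := Function.update (fun ζ => (g ζ⁻¹)⁻¹) 0 0 with hh
  have hne : ∀ ζ ≠ 0, h ζ = (g ζ⁻¹)⁻¹ := fun ζ hζ => Function.update_of_ne hζ _ _
  have h0 : h 0 = 0 := Function.update_self _ _ _
  have hgne : ∀ᶠ ζ in 𝓝[≠] (0 : ℂ), g ζ⁻¹ ≠ 0 := (hgc.comp hinv).eventually (eventually_ne_cobounded 0)
  have hcont : ContinuousAt h 0 := by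
    rw [hh, continuousAt_update_same]
    exact hinv'.comp (hgc.comp hinv)
  have hdiff : ∀ᶠ ζ in 𝓝[≠] (0 : ℂ), DifferentiableAt ℂ h ζ := by
    filter_upwards [hgne, hinv.eventually hd, self_mem_nhdsWithin] with ζ h1 h2 h3
    have h4 : DifferentiableAt ℂ (fun ζ => (g ζ⁻¹)⁻¹) ζ :=
      (h2.comp ζ (differentiableAt_inv h3)).inv h1
    refine h4.congr_of_eventuallyEq ?_
    filter_upwards [isOpen_ne.mem_nhds h3] with ξ hξ using hne ξ hξ
  have han : AnalyticAt ℂ h 0 :=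
    Complex.analyticAt_of_differentiable_on_punctured_nhds_of_continuousAt hdiff hcont
  have hopen : 𝓝 (0 : ℂ) ≤ map h (𝓝 0) := by
    rcases han.eventually_constant_or_nhds_le_map_nhds with hc | hc
    · obtain ⟨ζ, h1, h2, h3⟩ :=
        ((hc.filter_mono nhdsWithin_le_nhds).and (hgne.and self_mem_nhdsWithin)).exists
      rw [h0, hne ζ h3, inv_eq_zero] at h1
      exact absurd h1 h2
    · rwa [h0] at hc
  intro s hs
  have hT : {ζ : ℂ | ζ = 0 ∨ g ζ⁻¹ ∈ s} ∈ 𝓝 (0 : ℂ) := by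
    have h1 := hinv.eventually hs
    rw [eventually_nhdsWithin_iff] at h1
    filter_upwards [h1] with ζ hζ
    exact or_iff_not_imp_left.2 hζ
  have himg : h '' {ζ : ℂ | ζ = 0 ∨ g ζ⁻¹ ∈ s} ∈ 𝓝 (0 : ℂ) := hopen (image_mem_map hT)
  filter_upwards [hinv'.eventually himg, eventually_ne_cobounded (0 : ℂ)] with u hu hu0
  obtain ⟨ζ, hζ, hζu⟩ := hu
  have hζ0 : ζ ≠ 0 := by
    rintro rfl
    rw [h0] at hζu
    exact inv_ne_zero hu0 hζu.symm
  rw [hne ζ hζ0, inv_inj] at hζu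
  rw [← hζu]
  exact hζ.resolve_left hζ0

namespace IsHullMap

variable {K : Set ℂ} {g : ℂ → ℂ} {S : Set ℝ}

lemma isClosed_Kdoub (K : Set ℂ) : IsClosed (Kdoub K) := by
  refine isClosed_closure.union ?_
  rw [Set.image_eq_preimage_of_inverse (g := starRingEnd ℂ) Complex.conj_conj Complex.conj_conj]
  exact isClosed_closure.preimage Complex.continuous_conj

lemma im_nonneg (h : IsHullMap K g S) {z : ℂ} (hz : z ∈ closure K) : 0 ≤ z.im := by
  have : closure K ⊆ {z : ℂ | 0 ≤ z.im} :=
    closure_minimal (fun z hz => le_of_lt (show 0 < z.im from h.subset_UHP hz))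
      (isClosed_le continuous_const Complex.continuous_im)
  exact this hz

lemma notMem_Kdoub (h : IsHullMap K g S) {z : ℂ} (hz : 0 ≤ z.im) (hzK : z ∉ closure K) :
    z ∉ Kdoub K := by
  rintro (hz' | ⟨u, hu, rfl⟩)
  · exact hzK hz'
  · have h1 := h.im_nonneg hu
    rw [Complex.conj_im] at hz
    have h2 : (starRingEnd ℂ) u = u := Complex.conj_eq_iff_im.2 (by linarith)
    rw [h2] at hzK
    exact hzK hu

lemma notMem_closure (h : IsHullMap K g S) {z : ℂ} (hz : z ∈ UHP \ K) : z ∉ closure K :=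
  fun h' => hz.2 (h.relClosed z h' hz.1)

lemma differentiableAt (h : IsHullMap K g S) (hne : K.Nonempty) {z : ℂ} (hz : z ∉ Kdoub K) :
    DifferentiableAt ℂ g z :=
  (h.ext_holo hne).differentiableAt ((isClosed_Kdoub K).isOpen_compl.mem_nhds hz)

lemma mem_UHP_diff_of_map_mem (h : IsHullMap K g S) (hne : K.Nonempty) {z : ℂ}
    (hz : z ∉ Kdoub K) (hgz : g z ∈ UHP) : z ∈ UHP \ K := by
  refine ⟨?_, fun hzK => hz (Or.inl (subset_closure hzK))⟩
  by_contra hle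
  have hle' : z.im ≤ 0 := not_lt.1 hle
  rcases hle'.eq_or_lt with h0 | hlt
  · have h1 : ((z.re : ℝ) : ℂ) = z := Complex.ext rfl h0.symm
    have := h.real_vals hne z.re (by rwa [h1])
    rw [h1] at this
    exact absurd hgz (by simp [UHP, this])
  · have h1 : (starRingEnd ℂ) z ∈ UHP \ K := by
      refine ⟨?_, fun hzK => hz (Or.inr ⟨_, subset_closure hzK, Complex.conj_conj z⟩)⟩
      simpa [UHP] using hlt
    have h2 : g ((starRingEnd ℂ) z) ∈ UHP := h.bij.mapsTo h1
    rw [h.conj_symm hne z hz] at h2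
    simp only [UHP, Set.mem_ofPred_eq, Complex.conj_im] at h2 hgz
    linarith

lemma tendsto_add_mul_I (z : ℂ) : Tendsto (fun t : ℝ => z + t * I) (𝓝[>] 0) (𝓝 z) := by
  have : Continuous fun t : ℝ => z + t * I := by fun_prop
  simpa using (this.tendsto 0).mono_left nhdsWithin_le_nhds

lemma eventually_add_mul_I_mem {z : ℂ} (hz : 0 ≤ z.im)
    (hzK : z ∉ closure K) : ∀ᶠ t : ℝ in 𝓝[>] 0, z + t * I ∈ UHP \ K := by
  filter_upwards [(tendsto_add_mul_I z).eventually (isClosed_closure.isOpen_compl.mem_nhds hzK),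
    self_mem_nhdsWithin] with t ht ht0
  refine ⟨?_, fun hK => ht (subset_closure hK)⟩
  have : 0 < t := ht0
  simp [UHP]
  linarith

lemma nhds_le_map (h : IsHullMap K g S) (hne : K.Nonempty) {z : ℂ} (hz : 0 ≤ z.im)
    (hzK : z ∉ closure K) : 𝓝 (g z) ≤ map g (𝓝 z) := by
  have han : AnalyticAt ℂ g z :=
    (h.ext_holo hne).analyticAt
      ((isClosed_Kdoub K).isOpen_compl.mem_nhds (h.notMem_Kdoub hz hzK))
  refine han.eventually_constant_or_nhds_le_map_nhds.resolve_left fun hc => ?_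
  have hev := (eventually_add_mul_I_mem hz hzK).and ((tendsto_add_mul_I z).eventually hc)
  have hhalf : Tendsto (fun t : ℝ => t / 2) (𝓝[>] 0) (𝓝[>] 0) := by
    refine tendsto_nhdsWithin_iff.2 ⟨?_, ?_⟩
    · have : Continuous fun t : ℝ => t / 2 := by fun_prop
      simpa using (this.tendsto 0).mono_left nhdsWithin_le_nhds
    · filter_upwards [self_mem_nhdsWithin] with t ht using half_pos (Set.mem_Ioi.1 ht)
  obtain ⟨t, ⟨h1, h2⟩, ⟨h3, h4⟩, ht⟩ :=
    (hev.and ((hhalf.eventually hev).and self_mem_nhdsWithin)).exists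
  have heq := h.bij.injOn h1 h3 (h2.trans h4.symm)
  have him := congrArg Complex.im heq
  simp at him
  have : 0 < t := ht
  linarith

/-- Preimages in `ℍ \ K` of points of `ℍ` close to `g z` are close to `z`. -/
lemma eventually_mem_of_map_nhds (h : IsHullMap K g S) (hne : K.Nonempty) {z : ℂ} (hz : 0 ≤ z.im)
    (hzK : z ∉ closure K) {U : Set ℂ} (hU : U ∈ 𝓝 z) :
    ∀ᶠ u in 𝓝 (g z), ∀ v ∈ UHP \ K, g v = u → v ∈ U := by
  have hU' : U ∩ (Kdoub K)ᶜ ∈ 𝓝 z :=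
    inter_mem hU ((isClosed_Kdoub K).isOpen_compl.mem_nhds (h.notMem_Kdoub hz hzK))
  filter_upwards [h.nhds_le_map hne hz hzK (image_mem_map hU')]
  rintro _ ⟨v', hv', rfl⟩ v hv hvv
  have hv'' := h.mem_UHP_diff_of_map_mem hne hv'.2 (by rw [← hvv]; exact h.bij.mapsTo hv)
  rw [h.bij.injOn hv hv'' hvv]
  exact hv'.1

lemma map_ofReal (h : IsHullMap K g S) (hne : K.Nonempty) {x : ℝ} (hx : (x : ℂ) ∉ closure K) :
    (((g x).re : ℝ) : ℂ) = g x :=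
  Complex.ext rfl (h.real_vals hne x (h.notMem_Kdoub (by simp) hx)).symm

lemma continuousAt_re (h : IsHullMap K g S) (hne : K.Nonempty) {x : ℝ}
    (hx : (x : ℂ) ∉ closure K) : ContinuousAt (fun t : ℝ => (g t).re) x :=
  Complex.continuous_re.continuousAt.comp
    (ContinuousAt.comp (h.differentiableAt hne (h.notMem_Kdoub (by simp) hx)).continuousAt
      Complex.continuous_ofReal.continuousAt)

lemma tendsto_re_sub (h : IsHullMap K g S) :
    Tendsto (fun x : ℝ => (g x).re - x) (cobounded ℝ) (𝓝 0) := by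
  have h1 : Tendsto (fun x : ℝ => (x : ℂ)) (cobounded ℝ) (cobounded ℂ) := by
    rw [← tendsto_norm_atTop_iff_cobounded]
    simpa only [Complex.norm_real] using tendsto_norm_cobounded_atTop (E := ℝ)
  have h2 := (Complex.continuous_re.tendsto 0).comp (h.hydro.comp h1)
  simpa [Function.comp_def] using h2

lemma surjective_re (h : IsHullMap K g S) (hne : K.Nonempty)
    (hK : ∀ x : ℝ, (x : ℂ) ∉ closure K) : Function.Surjective fun x : ℝ => (g x).re := by
  have hc : Continuous fun x : ℝ => (g x).re :=
    continuous_iff_continuousAt.2 fun x => h.continuousAt_re hne (hK x)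
  have h1 := h.tendsto_re_sub
  rw [IsOrderBornology.cobounded_eq, tendsto_sup] at h1
  refine hc.surjective ?_ ?_
  · simpa using h1.2.add_atTop tendsto_id
  · simpa using h1.1.add_atBot tendsto_id

lemma isCompact_trace (h : IsHullMap K g S) : IsCompact {x : ℝ | (x : ℂ) ∈ closure K} := by
  have hc : IsCompact (closure K) := h.bounded.isCompact_closure
  exact Complex.isometry_ofReal.isClosedEmbedding.isCompact_preimage hc

lemma eventually_differentiableAt (h : IsHullMap K g S) (hne : K.Nonempty) :
    ∀ᶠ z in cobounded ℂ, DifferentiableAt ℂ g z ∧ z ∉ Kdoub K := by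
  have hb : IsBounded (Kdoub K) := by
    refine h.bounded.closure.union ?_
    exact (h.bounded.isCompact_closure.image Complex.continuous_conj).isBounded
  have : ∀ᶠ z in cobounded ℂ, z ∉ Kdoub K := isBounded_def.1 hb
  filter_upwards [this] with z hz using ⟨h.differentiableAt hne hz, hz⟩

lemma trace_nonempty (h : IsHullMap K g S) (hne : K.Nonempty) :
    {x : ℝ | (x : ℂ) ∈ closure K}.Nonempty := by
  by_contra hempty
  have hK : ∀ x : ℝ, (x : ℂ) ∉ closure K := fun x hx => hempty ⟨x, hx⟩
  have hcl : closure K ⊆ K := by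
    intro z hz
    refine h.relClosed z hz (lt_of_le_of_ne (h.im_nonneg hz) fun h0 => hK z.re ?_)
    rwa [show ((z.re : ℝ) : ℂ) = z from Complex.ext rfl h0]
  have hlow : (-I : ℂ) ∉ K := fun hI => by
    have h1 : 0 < (-I).im := h.subset_UHP hI
    norm_num at h1
  obtain ⟨z₀, hz₀⟩ : (frontier K).Nonempty :=
    nonempty_frontier_iff.2 ⟨hne, fun hu => hlow (hu ▸ Set.mem_univ _)⟩
  have hz₀K : z₀ ∈ K := hcl hz₀.1
  have hF : (𝓝[UHP \ K] z₀).NeBot := by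
    rw [← mem_closure_iff_nhdsWithin_neBot]
    have h1 : z₀ ∈ closure Kᶜ := by
      rw [closure_compl]
      exact hz₀.2
    have hopen : IsOpen UHP := isOpen_lt continuous_const Complex.continuous_im
    exact hopen.inter_closure ⟨h.subset_UHP hz₀K, h1⟩
  have hcov : ∀ y : ℂ, 0 ≤ y.im → ∃ z : ℂ, 0 ≤ z.im ∧ z ∉ closure K ∧ g z = y := by
    intro y hy
    rcases hy.eq_or_lt with h0 | hpos
    · obtain ⟨x, hx⟩ := h.surjective_re hne hK y.re
      refine ⟨x, by simp, hK x, ?_⟩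
      rw [← h.map_ofReal hne (hK x)]
      exact Complex.ext hx h0
    · obtain ⟨z, hz, rfl⟩ := h.bij.surjOn hpos
      exact ⟨z, hz.1.le, h.notMem_closure hz, rfl⟩
  have hbdd : ∃ R : ℝ, ∀ᶠ z in 𝓝[UHP \ K] z₀, g z ∈ closedBall 0 R := by
    have hev := h.eventually_differentiableAt hne
    have hmap := cobounded_le_map_of_tendsto_sub (hev.mono fun _ => And.left) h.hydro
    have hfar : {z : ℂ | z ∉ Kdoub K ∧ z ∉ closedBall z₀ 1} ∈ cobounded ℂ :=
      (hev.mono fun _ => And.right).and (isBounded_def.1 isBounded_closedBall)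
    have himg := hmap (image_mem_map hfar)
    obtain ⟨R, -, hR⟩ := (hasBasis_cobounded_compl_closedBall (0 : ℂ)).mem_iff.1 himg
    refine ⟨R, ?_⟩
    filter_upwards [self_mem_nhdsWithin,
      mem_nhdsWithin_of_mem_nhds (closedBall_mem_nhds z₀ one_pos)] with z hz hzb
    by_contra hgz
    obtain ⟨v, hv, hvz⟩ := hR hgz
    have hv' := h.mem_UHP_diff_of_map_mem hne hv.1 (by rw [hvz]; exact h.bij.mapsTo hz)
    rw [h.bij.injOn hv' hz hvz] at hv
    exact hv.2 hzb
  obtain ⟨R, hR⟩ := hbdd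
  have hmem : ∀ᶠ z in 𝓝[UHP \ K] z₀, g z ∈ closedBall 0 R ∩ {y : ℂ | 0 ≤ y.im} := by
    filter_upwards [hR, self_mem_nhdsWithin] with z hz hz'
    exact ⟨hz, le_of_lt (show 0 < (g z).im from h.bij.mapsTo hz')⟩
  have hcomp : IsCompact (closedBall (0 : ℂ) R ∩ {y : ℂ | 0 ≤ y.im}) :=
    (isCompact_closedBall 0 R).inter_right (isClosed_le continuous_const Complex.continuous_im)
  obtain ⟨y, hy, hcl'⟩ := hcomp (f := map g (𝓝[UHP \ K] z₀)) (le_principal_iff.2 hmem)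
  obtain ⟨z, hz, hzK, rfl⟩ := hcov y hy.2
  have hzz : z ≠ z₀ := fun he => hzK (he ▸ subset_closure hz₀K)
  obtain ⟨U, hU, V, hV, hUV⟩ := Filter.disjoint_iff.1 (disjoint_nhds_nhds.2 hzz)
  have hfreq : ∃ᶠ v in 𝓝[UHP \ K] z₀, ∀ v' ∈ UHP \ K, g v' = g v → v' ∈ U :=
    mapClusterPt_iff_frequently.1 hcl' _ (h.eventually_mem_of_map_nhds hne hz hzK hU)
  have hnear : ∀ᶠ v in 𝓝[UHP \ K] z₀, v ∈ V ∧ v ∈ UHP \ K :=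
    inter_mem (mem_nhdsWithin_of_mem_nhds hV) self_mem_nhdsWithin
  obtain ⟨v, hv, hvV, hvK⟩ := (hfreq.and_eventually hnear).exists
  exact Set.disjoint_left.1 hUV (hv v hvK rfl) hvV

lemma isRealHullMap (h : IsHullMap K g S) (hne : K.Nonempty) :
    IsRealHullMap {x : ℝ | (x : ℂ) ∈ closure K} (fun t : ℝ => (g t).re) where
  compact := h.isCompact_trace
  nonempty := h.trace_nonempty hne
  cont := fun _ hx => (h.continuousAt_re hne hx).continuousWithinAt
  inj := by
    have hout : ∀ x ∈ (Set.Icc (aK K) (bK K))ᶜ, (x : ℂ) ∉ closure K := fun x hx hxK =>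
      hx ⟨csInf_le h.isCompact_trace.bddBelow hxK, le_csSup h.isCompact_trace.bddAbove hxK⟩
    have hmem : ∀ x ∈ (Set.Icc (aK K) (bK K))ᶜ, (x : ℂ) ∈ {z : ℂ | z ∉ Kdoub K ∧ z ∉ seg K} := by
      intro x hx
      refine ⟨h.notMem_Kdoub (by simp) (hout x hx), ?_⟩
      rintro ⟨t, ht, htx⟩
      rw [Complex.ofReal_inj] at htx
      exact hx (htx ▸ ht)
    intro x hx y hy hxy
    refine Complex.ofReal_injective ((h.extBij hne).injOn (hmem x hx) (hmem y hy) ?_)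
    rw [← h.map_ofReal hne (hout x hx), ← h.map_ofReal hne (hout y hy)]
    exact congrArg _ hxy
  asymp := h.tendsto_re_sub

section Quotient

variable {L : Set ℂ} {gK gL gq : ℂ → ℂ} {SK SL Sq : Set ℝ}

lemma map_notMem_closure_image (hK : IsHullMap K gK SK) (hL : IsHullMap L gL SL)
    (hLne : L.Nonempty) (hsub : L ⊆ K) {x : ℝ} (hx : (x : ℂ) ∉ closure K) :
    gL x ∉ closure (gL '' (K \ L)) := by
  intro hmem
  have hxL : (x : ℂ) ∉ closure L := fun h => hx (closure_mono hsub h)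
  have hev := hL.eventually_mem_of_map_nhds hLne (by simp) hxL
    (isClosed_closure.isOpen_compl.mem_nhds hx)
  obtain ⟨_, hu, z, hz, rfl⟩ := mem_closure_iff_nhds.1 hmem _ hev
  exact hu z ⟨hK.subset_UHP hz.1, hz.2⟩ rfl (subset_closure hz.1)

lemma map_mem_closure_image (hL : IsHullMap L gL SL) (hLne : L.Nonempty) {x : ℝ}
    (hx : (x : ℂ) ∈ closure K) (hxL : (x : ℂ) ∉ closure L) :
    gL x ∈ closure (gL '' (K \ L)) := by
  have hc : ContinuousAt gL x :=
    (hL.differentiableAt hLne (hL.notMem_Kdoub (by simp) hxL)).continuousAt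
  refine mem_closure_image hc ?_
  rw [mem_closure_iff_nhds] at hx ⊢
  intro t ht
  obtain ⟨z, ⟨hzt, hzL⟩, hzK⟩ :=
    hx _ (inter_mem ht (isClosed_closure.isOpen_compl.mem_nhds hxL))
  exact ⟨z, hzt, hzK, fun h => hzL (subset_closure h)⟩

lemma comp_ofReal (hK : IsHullMap K gK SK) (hL : IsHullMap L gL SL)
    (hq : IsHullMap (gL '' (K \ L)) gq Sq)
    (hLne : L.Nonempty) (hKLne : (K \ L).Nonempty) (hsub : L ⊆ K)
    (hcomp : ∀ z ∈ UHP \ K, gq (gL z) = gK z) {x : ℝ} (hx : (x : ℂ) ∉ closure K) :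
    gq (gL x) = gK x := by
  have hxL : (x : ℂ) ∉ closure L := fun h => hx (closure_mono hsub h)
  have hgx := hL.map_ofReal hLne hxL
  have hcK : ContinuousAt gK x := (hK.differentiableAt (hLne.mono hsub)
    (hK.notMem_Kdoub (by simp) hx)).continuousAt
  have hcL : ContinuousAt gL x :=
    (hL.differentiableAt hLne (hL.notMem_Kdoub (by simp) hxL)).continuousAt
  have hcq : ContinuousAt gq (gL x) := (hq.differentiableAt (hKLne.image gL)
    (hq.notMem_Kdoub (by rw [← hgx]; simp)
      (map_notMem_closure_image hK hL hLne hsub hx))).continuousAt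
  refine tendsto_nhds_unique (f := fun t : ℝ => gq (gL (x + t * I))) (l := 𝓝[>] 0)
    (hcq.tendsto.comp (hcL.tendsto.comp (tendsto_add_mul_I x))) ?_
  refine (hcK.tendsto.comp (tendsto_add_mul_I x)).congr' ?_
  filter_upwards [eventually_add_mul_I_mem (by simp) hx] with t ht using (hcomp _ ht).symm

end Quotient

end IsHullMap

/-- **Composition identity for modified Loewner maps.** Let `L ⊆ K` be `ℍ`-hulls, `w ∈ ℝ`,
`w̃ ∈ [c_L^w, d_L^w]`. With the revision that a value `g_L^w(x) = w̃` is regarded as the point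
`w̃^{sign(x-w)}` of `ℝ_{w̃}`, one has `g_{K/L}^{w̃} ∘ g_L^w = g_K^w` on `ℝ_w`. -/
theorem stmt_10 (K L : Set ℂ) (gK gL gq : ℂ → ℂ) (SK SL Sq : Set ℝ)
    (hK : IsHullMap K gK SK) (hL : IsHullMap L gL SL)
    (hq : IsHullMap (gL '' (K \ L)) gq Sq)
    (hLne : L.Nonempty) (hKLne : (K \ L).Nonempty) (hsub : L ⊆ K)
    (hcomp : ∀ z ∈ UHP \ K, gq (gL z) = gK z)
    (w wtld : ℝ) (hwtld : wtld ∈ Set.Icc (cwF gL L w) (dwF gL L w)) :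
    ∀ (x : ℝ) (s : Bool),
      gmod gK K w x s =
        gmod gq (gL '' (K \ L)) wtld (gmod gL L w x s)
          (decide (w < x ∨ (x = w ∧ s = true))) := by
  have hQne : (gL '' (K \ L)).Nonempty := hKLne.image gL
  have rK := hK.isRealHullMap (hLne.mono hsub)
  have rL := hL.isRealHullMap hLne
  have rQ := hq.isRealHullMap hQne
  have hre : ∀ x : ℝ, (x : ℂ) ∉ closure L → (((gL x).re : ℝ) : ℂ) = gL x :=
    fun x hx => hL.map_ofReal hLne hx
  have hsub' : {x : ℝ | (x : ℂ) ∈ closure L} ⊆ {x : ℝ | (x : ℂ) ∈ closure K} :=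
    fun x hx => closure_mono hsub hx
  have hnot : ∀ x ∉ {x : ℝ | (x : ℂ) ∈ closure K},
      (gL x).re ∉ {x : ℝ | (x : ℂ) ∈ closure (gL '' (K \ L))} := by
    intro x hx
    rw [Set.mem_ofPred_eq, hre x fun h => hx (hsub' h)]
    exact IsHullMap.map_notMem_closure_image hK hL hLne hsub hx
  have hmem : ∀ x ∈ {x : ℝ | (x : ℂ) ∈ closure K}, x ∉ {x : ℝ | (x : ℂ) ∈ closure L} →
      (gL x).re ∈ {x : ℝ | (x : ℂ) ∈ closure (gL '' (K \ L))} := by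
    intro x hx hxL
    rw [Set.mem_ofPred_eq, hre x hxL]
    exact hL.map_mem_closure_image hLne hx hxL
  have hcomp' : ∀ x ∉ {x : ℝ | (x : ℂ) ∈ closure K}, (gq ((gL x).re : ℝ)).re = (gK x).re := by
    intro x hx
    rw [hre x fun h => hx (hsub' h),
      IsHullMap.comp_ofReal hK hL hq hLne hKLne hsub hcomp hx]
  intro x s
  by_cases hs : w < x ∨ (x = w ∧ s = true)
  · have hd : dwF gL L w ≤ gmod gL L w x s := by
      rw [gmod_eq_rightMap rL hs]
      exact rL.rightMap_mono (hs.elim le_of_lt fun h => h.1.ge)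
    rw [decide_eq_true hs, gmod_eq_rightMap rK hs, gmod_eq_rightMap rQ, gmod_eq_rightMap rL hs]
    · exact rK.rightMap_comp rL rQ hsub' hnot hmem hcomp' x
    · exact (hwtld.2.trans hd).lt_or_eq.imp id fun h => ⟨h.symm, rfl⟩
  · have hs' : x < w ∨ (x = w ∧ s = false) := by
      push Not at hs
      rcases hs.1.lt_or_eq with h | h
      · exact Or.inl h
      · exact Or.inr ⟨h, by simpa using hs.2 h⟩
    have hc : gmod gL L w x s ≤ cwF gL L w := by
      rw [gmod_eq_leftMap rL hs']
      exact rL.leftMap_mono (hs'.elim le_of_lt fun h => h.1.le)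
    rw [decide_eq_false hs, gmod_eq_leftMap rK hs', gmod_eq_leftMap rQ, gmod_eq_leftMap rL hs']
    · exact rK.leftMap_comp rL rQ hsub' hnot hmem hcomp' x
    · exact (hc.trans hwtld.1).lt_or_eq.imp id fun h => ⟨h, rfl⟩
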